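/- For every prime q, the natural density d(q) of M(q) exists and equals 1 - (1 - 1/q) · ∏_{p prime, p ≠ q} [(1 - 1/p) · Σ_{m ∈ M^c(q)} 1/p^m], where the product is over all primes p different from q. -/

import Mathlib

open Filter Topology

/-- `TowerMem q n` means that the prime `q` occurs somewhere in the tower
factorization of the positive integer `n`:  `1 ∉ M(q)`, and for `n ≥ 2`,
`n ∈ M(q)` iff `q ∣ n` or some exponent in the prime factorization of `n`
lies in `M(q)`. -/
inductive TowerMem (q : ℕ) : ℕ → Prop
  | base (n : ℕ) (hn : 2 ≤ n) (hdvd : q ∣ n) : TowerMem q n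
  | step (n p : ℕ) (hn : 2 ≤ n) (hp : p.Prime) (hdvd : p ∣ n)
      (hexp : TowerMem q (n.factorization p)) : TowerMem q n

open Classical in
/-- The proportion of the integers `{1, …, N}` that lie in `M(q)`. -/
noncomputable def towerRatio (q N : ℕ) : ℝ :=
  (((Finset.Icc 1 N).filter fun n => TowerMem q n).card : ℝ) / (N : ℝ)

lemma not_towerMem_of_lt_two {q n : ℕ} (hn : n < 2) : ¬ TowerMem q n := by
  rintro (⟨_, h, _⟩ | ⟨_, _, h, _⟩) <;> omega

lemma not_towerMem_iff {q n : ℕ} (hq : q.Prime) (hn : n ≠ 0) :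
    ¬ TowerMem q n ↔ n.factorization q = 0 ∧
      ∀ p : {p : ℕ // p.Prime ∧ p ≠ q}, ¬ TowerMem q (n.factorization p) := by
  constructor
  · intro h
    have two_le : ∀ p : ℕ, p.Prime → p ∣ n → 2 ≤ n := fun p hp hpn =>
      hp.two_le.trans (Nat.le_of_dvd (Nat.pos_of_ne_zero hn) hpn)
    refine ⟨?_, fun p hp => ?_⟩
    · by_contra h0
      have hdvd := Nat.dvd_of_factorization_pos h0
      exact h (.base n (two_le q hq hdvd) hdvd)
    · have hdvd : (p : ℕ) ∣ n := by
        apply Nat.dvd_of_factorization_pos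
        intro h0
        rw [h0] at hp
        exact not_towerMem_of_lt_two (by norm_num) hp
      exact h (.step n p (two_le p p.2.1 hdvd) p.2.1 hdvd hp)
  · rintro ⟨h0, h⟩ hmem
    have hqn : ¬ q ∣ n := fun hdvd =>
      (hq.factorization_pos_of_dvd hn hdvd).ne' h0
    cases hmem with
    | base _ _ hdvd => exact hqn hdvd
    | step _ p _ hp hdvd hexp =>
      exact h ⟨p, hp, fun hpq => hqn (hpq ▸ hdvd)⟩ hexp

open Classical in
/-- The number of elements of `B` in `{1, …, N}`. -/
noncomputable def countUpTo (B : Set ℕ) (N : ℕ) : ℕ :=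
  ((Finset.Ioc 0 N).filter (· ∈ B)).card

/-- `B` has natural density `d`. -/
def HasNatDensity (B : Set ℕ) (d : ℝ) : Prop :=
  Tendsto (fun N : ℕ => (countUpTo B N : ℝ) / N) atTop (𝓝 d)

open Classical in
lemma countUpTo_le (B : Set ℕ) (N : ℕ) : countUpTo B N ≤ N := by
  simpa [countUpTo] using Finset.card_filter_le (Finset.Ioc 0 N) (· ∈ B)

open Classical in
lemma countUpTo_mono (B : Set ℕ) : Monotone (countUpTo B) := fun _ _ h =>
  Finset.card_le_card (Finset.filter_subset_filter _ (Finset.Ioc_subset_Ioc_right h))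

lemma hasNatDensity_univ : HasNatDensity Set.univ 1 := by
  refine tendsto_const_nhds.congr' ?_
  filter_upwards [eventually_gt_atTop 0] with N hN
  have : (N : ℝ) ≠ 0 := by positivity
  simp [countUpTo, this]

lemma HasNatDensity.tendsto_countUpTo_div {B : Set ℕ} {d : ℝ} (hB : HasNatDensity B d)
    {k : ℕ} (hk : 0 < k) :
    Tendsto (fun N : ℕ => (countUpTo B (N / k) : ℝ) / N) atTop (𝓝 (d * (1 / k))) := by
  have hdiv : Tendsto (fun N : ℕ => N / k) atTop atTop :=
    Nat.tendsto_div_const_atTop hk.ne'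
  have hquot : Tendsto (fun N : ℕ => ((N / k : ℕ) : ℝ) / N) atTop (𝓝 (1 / (k : ℝ))) := by
    refine ((tendsto_nat_floor_mul_div_atTop (R := ℝ) (a := 1 / (k : ℝ))
      (by positivity)).comp tendsto_natCast_atTop_atTop).congr fun N => ?_
    simp only [Function.comp_apply]
    rw [one_div_mul_eq_div, Nat.floor_div_eq_div]
  refine ((Tendsto.comp hB hdiv).mul hquot).congr' ?_
  filter_upwards [eventually_ge_atTop k] with N hN
  have : ((N / k : ℕ) : ℝ) ≠ 0 := by
    exact_mod_cast (Nat.div_pos hN hk).ne'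
  simp only [Function.comp_apply]
  field_simp

open Classical in
lemma card_filter_pow_dvd {B : Set ℕ} {p : ℕ} (hp : p.Prime)
    (hB : ∀ n, n ≠ 0 → (p * n ∈ B ↔ n ∈ B)) (N m : ℕ) :
    ((Finset.Ioc 0 N).filter (fun n => n ∈ B ∧ p ^ m ∣ n)).card = countUpTo B (N / p ^ m) := by
  have hpow : ∀ m n, n ≠ 0 → (p ^ m * n ∈ B ↔ n ∈ B) := by
    intro m
    induction m with
    | zero => simp
    | succ m ih =>
      intro n hn
      rw [pow_succ', mul_assoc, hB _ (mul_ne_zero (pow_ne_zero _ hp.ne_zero) hn), ih n hn]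
  have hpos : 0 < p ^ m := pow_pos hp.pos m
  symm
  refine Finset.card_bij (fun n _ => p ^ m * n) ?_ ?_ ?_
  · intro n hn
    simp only [Finset.mem_filter, Finset.mem_Ioc] at hn ⊢
    refine ⟨⟨Nat.mul_pos hpos hn.1.1, ?_⟩, (hpow m n hn.1.1.ne').2 hn.2, dvd_mul_right _ _⟩
    rw [mul_comm]
    exact (Nat.le_div_iff_mul_le hpos).1 hn.1.2
  · intro a _ b _ h
    exact Nat.eq_of_mul_eq_mul_left hpos h
  · intro n hn
    simp only [Finset.mem_filter, Finset.mem_Ioc] at hn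
    obtain ⟨⟨h0, hN⟩, hnB, k, rfl⟩ := hn
    have hk : 0 < k := Nat.pos_of_mul_pos_left h0
    refine ⟨k, ?_, rfl⟩
    simp only [Finset.mem_filter, Finset.mem_Ioc]
    exact ⟨⟨hk, (Nat.le_div_iff_mul_le hpos).2 (by rwa [mul_comm])⟩, (hpow m k hk.ne').1 hnB⟩

open Classical in
lemma card_filter_factorization_eq {B : Set ℕ} {p : ℕ} (hp : p.Prime)
    (hB : ∀ n, n ≠ 0 → (p * n ∈ B ↔ n ∈ B)) (N m : ℕ) :
    ((Finset.Ioc 0 N).filter (fun n => n ∈ B ∧ n.factorization p = m)).card +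
      countUpTo B (N / p ^ (m + 1)) = countUpTo B (N / p ^ m) := by
  rw [← card_filter_pow_dvd hp hB, ← card_filter_pow_dvd hp hB, ← Finset.card_union_of_disjoint]
  · congr 1
    ext n
    simp only [Finset.mem_union, Finset.mem_filter, Finset.mem_Ioc]
    rcases Nat.eq_zero_or_pos n with rfl | hn
    · simp
    · rw [hp.pow_dvd_iff_le_factorization hn.ne', hp.pow_dvd_iff_le_factorization hn.ne']
      have : m ≤ n.factorization p ↔ n.factorization p = m ∨ m + 1 ≤ n.factorization p := by omega
      rw [this]
      tauto
  · rw [Finset.disjoint_left]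
    intro n h1 h2
    simp only [Finset.mem_filter, Finset.mem_Ioc] at h1 h2
    have := (hp.pow_dvd_iff_le_factorization h1.1.1.ne').1 h2.2.2
    omega

open Classical in
lemma countUpTo_factorization_mem {B : Set ℕ} {p : ℕ} (hp : p.Prime)
    (hB : ∀ n, n ≠ 0 → (p * n ∈ B ↔ n ∈ B)) (A : Set ℕ) (N : ℕ) :
    (countUpTo {n | n ∈ B ∧ n.factorization p ∈ A} N : ℝ) =
      ∑' m, A.indicator
        (fun m => (countUpTo B (N / p ^ m) : ℝ) - countUpTo B (N / p ^ (m + 1))) m := by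
  rw [tsum_eq_sum (s := Finset.range (N + 1))]
  · rw [countUpTo, Finset.card_eq_sum_card_fiberwise (f := fun n => n.factorization p)
      (t := Finset.range (N + 1))]
    · rw [Nat.cast_sum]
      refine Finset.sum_congr rfl fun m _ => ?_
      by_cases hm : m ∈ A
      · rw [Set.indicator_of_mem hm, ← card_filter_factorization_eq hp hB N m]
        push_cast
        rw [add_sub_cancel_right]
        congr 2
        ext n
        simp only [Finset.mem_filter, Set.mem_ofPred_eq]
        constructor
        · rintro ⟨⟨h1, h2, _⟩, h3⟩
          exact ⟨h1, h2, h3⟩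
        · rintro ⟨h1, h2, h3⟩
          exact ⟨⟨h1, h2, h3 ▸ hm⟩, h3⟩
      · rw [Set.indicator_of_notMem hm, Nat.cast_eq_zero, Finset.card_eq_zero,
          Finset.filter_eq_empty_iff]
        intro n hn h3
        simp only [Finset.mem_filter, Set.mem_ofPred_eq] at hn
        exact hm (h3 ▸ hn.2.2)
    · intro n hn
      simp only [Finset.coe_filter, Finset.mem_Ioc, Set.mem_ofPred_eq] at hn
      have := Nat.factorization_lt p hn.1.1.ne'
      simp only [Finset.coe_range, Set.mem_Iio]
      omega
  · intro m hm
    have hlt : N < p ^ m := by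
      have := Nat.lt_pow_self hp.one_lt (n := m)
      simp only [Finset.mem_range] at hm
      omega
    have hlt' : N < p ^ (m + 1) := hlt.trans (Nat.pow_lt_pow_right hp.one_lt (by omega))
    simp only [Set.indicator_apply, Nat.div_eq_of_lt hlt, Nat.div_eq_of_lt hlt', sub_self, ite_self]

/-- If `B` is insensitive to the prime `p`, restricting the exponent of `p` to `A` multiplies the
density by the corresponding local factor. -/
lemma HasNatDensity.factorization_mem {B : Set ℕ} {d : ℝ} (hd : HasNatDensity B d)
    {p : ℕ} (hp : p.Prime) (hB : ∀ n, n ≠ 0 → (p * n ∈ B ↔ n ∈ B)) (A : Set ℕ) :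
    HasNatDensity {n | n ∈ B ∧ n.factorization p ∈ A}
      (d * ((1 - 1 / (p : ℝ)) * ∑' m : A, 1 / (p : ℝ) ^ (m : ℕ))) := by
  have hp0 : (0 : ℝ) < p := by exact_mod_cast hp.pos
  have hp1 : (1 : ℝ) < p := by exact_mod_cast hp.one_lt
  have key : Tendsto (fun N : ℕ => ∑' m, A.indicator
        (fun m => ((countUpTo B (N / p ^ m) : ℝ) - countUpTo B (N / p ^ (m + 1))) / N) m) atTop
      (𝓝 (∑' m, A.indicator (fun m => d * (1 - 1 / (p : ℝ)) * (1 / (p : ℝ) ^ m)) m)) := by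
    refine tendsto_tsum_of_dominated_convergence (bound := fun m => (1 / (p : ℝ)) ^ m) ?_ ?_ ?_
    · exact summable_geometric_of_lt_one (by positivity) ((div_lt_one hp0).2 hp1)
    · intro m
      by_cases hm : m ∈ A
      · simp only [Set.indicator_of_mem hm]
        have h1 := hd.tendsto_countUpTo_div (pow_pos hp.pos m)
        have h2 := hd.tendsto_countUpTo_div (pow_pos hp.pos (m + 1))
        have h3 := h1.sub h2
        have e : d * (1 / ((p ^ m : ℕ) : ℝ)) - d * (1 / ((p ^ (m + 1) : ℕ) : ℝ)) =
            d * (1 - 1 / (p : ℝ)) * (1 / (p : ℝ) ^ m) := by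
          push_cast
          rw [pow_succ]
          field_simp
        rw [e] at h3
        exact h3.congr fun N => by rw [sub_div]
      · simp only [Set.indicator_of_notMem hm]
        exact tendsto_const_nhds
    · filter_upwards [eventually_gt_atTop 0] with N hN m
      have hN0 : (0 : ℝ) < N := by exact_mod_cast hN
      refine (norm_indicator_le_norm_self _ _).trans ?_
      have h1 : (countUpTo B (N / p ^ (m + 1)) : ℝ) ≤ countUpTo B (N / p ^ m) := by
        exact_mod_cast countUpTo_mono B
          (Nat.div_le_div_left (Nat.pow_le_pow_right hp.pos (by omega)) (pow_pos hp.pos m))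
      have h2 : (countUpTo B (N / p ^ m) : ℝ) ≤ N / (p : ℝ) ^ m := by
        refine le_trans (b := ((N / p ^ m : ℕ) : ℝ)) (by exact_mod_cast countUpTo_le _ _) ?_
        exact_mod_cast Nat.cast_div_le (α := ℝ) (m := N) (n := p ^ m)
      rw [Real.norm_of_nonneg (div_nonneg (by linarith) hN0.le), div_le_iff₀ hN0, one_div,
        inv_pow, inv_mul_eq_div]
      have : (0 : ℝ) ≤ countUpTo B (N / p ^ (m + 1)) := by positivity
      linarith
  rw [← mul_assoc, ← tsum_mul_left,
    tsum_subtype A (fun m => d * (1 - 1 / (p : ℝ)) * (1 / (p : ℝ) ^ m))]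
  refine key.congr fun N => ?_
  rw [countUpTo_factorization_mem hp hB, ← tsum_div_const]
  refine tsum_congr fun m => ?_
  by_cases hm : m ∈ A <;> simp [hm]

/-- The integers not divisible by `q` whose exponents at the primes of `S` avoid `M(q)`. -/
def partialCompl (q : ℕ) (S : Finset {p : ℕ // p.Prime ∧ p ≠ q}) : Set ℕ :=
  {n | n.factorization q = 0 ∧ ∀ p ∈ S, ¬ TowerMem q (n.factorization p)}

/-- The proportion of integers whose exponent at `p` avoids `M(q)`. -/
noncomputable def localFactor (q p : ℕ) : ℝ :=
  (1 - 1 / (p : ℝ)) * ∑' m : {m : ℕ // ¬ TowerMem q m}, 1 / (p : ℝ) ^ (m : ℕ)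

lemma mul_mem_partialCompl {q : ℕ} {S : Finset {p : ℕ // p.Prime ∧ p ≠ q}}
    {p : {p : ℕ // p.Prime ∧ p ≠ q}} (hp : p ∉ S) {n : ℕ} (hn : n ≠ 0) :
    (p : ℕ) * n ∈ partialCompl q S ↔ n ∈ partialCompl q S := by
  have h : ∀ r : ℕ, r ≠ p → ((p : ℕ) * n).factorization r = n.factorization r := by
    intro r hr
    rw [Nat.factorization_mul p.2.1.ne_zero hn, p.2.1.factorization]
    simp [hr.symm]
  simp only [partialCompl, Set.mem_ofPred_eq]
  rw [h q p.2.2.symm]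
  refine and_congr_right fun _ => forall₂_congr fun r hr => ?_
  rw [h r fun e => hp (Subtype.ext e ▸ hr)]

lemma hasNatDensity_partialCompl {q : ℕ} (hq : q.Prime)
    (S : Finset {p : ℕ // p.Prime ∧ p ≠ q}) :
    HasNatDensity (partialCompl q S) ((1 - 1 / (q : ℝ)) * ∏ p ∈ S, localFactor q p) := by
  classical
  induction S using Finset.induction_on with
  | empty =>
    have := hasNatDensity_univ.factorization_mem hq (by simp) {0}
    simpa [partialCompl] using this
  | insert p S hp ih =>
    have := ih.factorization_mem p.2.1 (fun n hn => mul_mem_partialCompl hp hn)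
      {m | ¬ TowerMem q m}
    rw [Finset.prod_insert hp, mul_comm (localFactor q p), ← mul_assoc]
    convert this using 1
    · ext n
      simp only [partialCompl, Set.mem_ofPred_eq, Finset.forall_mem_insert]
      tauto
    · rfl

lemma abs_localFactor_sub_one_le {q p : ℕ} (hp : p.Prime) :
    |localFactor q p - 1| ≤ 1 / (p : ℝ) ^ 2 := by
  have hp0 : (0 : ℝ) < p := by exact_mod_cast hp.pos
  have hp1 : (1 : ℝ) < p := by exact_mod_cast hp.one_lt
  have hlt : 1 / (p : ℝ) < 1 := (div_lt_one hp0).2 hp1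
  have hnn : 0 ≤ 1 - 1 / (p : ℝ) := by linarith
  have hsum : Summable fun m : ℕ => 1 / (p : ℝ) ^ m := by
    simpa only [one_div_pow] using summable_geometric_of_lt_one (by positivity) hlt
  have hsub : Summable fun m : {m : ℕ // ¬ TowerMem q m} => 1 / (p : ℝ) ^ (m : ℕ) :=
    hsum.comp_injective Subtype.val_injective
  have upper : localFactor q p ≤ 1 := by
    have h1 : ∑' m : {m : ℕ // ¬ TowerMem q m}, 1 / (p : ℝ) ^ (m : ℕ) ≤
        ∑' m : ℕ, 1 / (p : ℝ) ^ m :=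
      hsub.tsum_le_tsum_of_inj Subtype.val Subtype.val_injective
        (fun _ _ => by positivity) (fun _ => le_rfl) hsum
    have h2 : ∑' m : ℕ, 1 / (p : ℝ) ^ m = (1 - 1 / (p : ℝ))⁻¹ := by
      simpa only [one_div_pow] using tsum_geometric_of_lt_one (r := 1 / (p : ℝ)) (by positivity) hlt
    calc localFactor q p ≤ (1 - 1 / (p : ℝ)) * (1 - 1 / (p : ℝ))⁻¹ :=
          mul_le_mul_of_nonneg_left (h2 ▸ h1) hnn
      _ = 1 := mul_inv_cancel₀ (by linarith)
  have lower : 1 - 1 / (p : ℝ) ^ 2 ≤ localFactor q p := by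
    have h1 := hsub.sum_le_tsum
      {⟨0, not_towerMem_of_lt_two (by norm_num)⟩, ⟨1, not_towerMem_of_lt_two (by norm_num)⟩}
      (fun _ _ => by positivity)
    rw [Finset.sum_pair (by simp)] at h1
    calc 1 - 1 / (p : ℝ) ^ 2 = (1 - 1 / (p : ℝ)) * (1 / (p : ℝ) ^ 0 + 1 / (p : ℝ) ^ 1) := by
          field_simp
          ring
      _ ≤ localFactor q p := mul_le_mul_of_nonneg_left h1 hnn
  rw [abs_le]
  constructor
  · linarith
  · have : 0 ≤ 1 / (p : ℝ) ^ 2 := by positivity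
    linarith

lemma summable_one_div_sq (q : ℕ) :
    Summable fun p : {p : ℕ // p.Prime ∧ p ≠ q} => 1 / ((p : ℕ) : ℝ) ^ 2 :=
  (Real.summable_one_div_nat_pow.2 (by norm_num)).comp_injective Subtype.val_injective

lemma multipliable_localFactor (q : ℕ) :
    Multipliable fun p : {p : ℕ // p.Prime ∧ p ≠ q} => localFactor q p := by
  have h : Summable fun p : {p : ℕ // p.Prime ∧ p ≠ q} => localFactor q p - 1 :=
    (summable_one_div_sq q).of_norm_bounded fun p => abs_localFactor_sub_one_le p.2.1
  simpa using Real.multipliable_one_add_of_summable h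

lemma countUpTo_compl_le {q : ℕ} (hq : q.Prime) (S : Finset {p : ℕ // p.Prime ∧ p ≠ q}) (N : ℕ) :
    countUpTo {n | ¬ TowerMem q n} N ≤ countUpTo (partialCompl q S) N := by
  refine Finset.card_le_card fun n hn => ?_
  simp only [Finset.mem_filter, Finset.mem_Ioc, Set.mem_ofPred_eq] at hn ⊢
  have h := (not_towerMem_iff hq hn.1.1.ne').1 hn.2
  exact ⟨hn.1, h.1, fun p _ => h.2 p⟩

lemma countUpTo_partialCompl_le {q : ℕ} (hq : q.Prime) (S : Finset {p : ℕ // p.Prime ∧ p ≠ q})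
    (N : ℕ) :
    (countUpTo (partialCompl q S) N : ℝ) ≤ countUpTo {n | ¬ TowerMem q n} N +
      N * (∑' p : {p : ℕ // p.Prime ∧ p ≠ q}, 1 / ((p : ℕ) : ℝ) ^ 2 -
        ∑ p ∈ S, 1 / ((p : ℕ) : ℝ) ^ 2) := by
  classical
  set T : Finset {p : ℕ // p.Prime ∧ p ≠ q} :=
    ((Finset.range (N + 1)).subtype _) \ S with hT
  have hsub : (Finset.Ioc 0 N).filter (· ∈ partialCompl q S) ⊆
      (Finset.Ioc 0 N).filter (· ∈ {n | ¬ TowerMem q n}) ∪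
        T.biUnion fun p => (Finset.Ioc 0 N).filter fun n => (p : ℕ) ^ 2 ∣ n := by
    intro n hn
    simp only [Finset.mem_filter, Finset.mem_union, Finset.mem_biUnion, Set.mem_ofPred_eq] at hn ⊢
    have hn0 : 0 < n := (Finset.mem_Ioc.1 hn.1).1
    by_cases hmem : TowerMem q n
    · right
      have h : ∃ p : {p : ℕ // p.Prime ∧ p ≠ q}, TowerMem q (n.factorization p) := by
        by_contra! h
        exact (not_towerMem_iff hq hn0.ne').2 ⟨hn.2.1, h⟩ hmem
      obtain ⟨p, hp⟩ := h
      have h2 : 2 ≤ n.factorization p := by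
        by_contra! h2
        exact not_towerMem_of_lt_two h2 hp
      have hdvd : (p : ℕ) ^ 2 ∣ n := (p.2.1.pow_dvd_iff_le_factorization hn0.ne').2 h2
      have hle : (p : ℕ) ≤ N :=
        (Nat.le_of_dvd hn0 ((dvd_pow_self _ two_ne_zero).trans hdvd)).trans (Finset.mem_Ioc.1 hn.1).2
      refine ⟨p, ?_, hn.1, hdvd⟩
      rw [hT, Finset.mem_sdiff, Finset.mem_subtype, Finset.mem_range]
      exact ⟨by omega, fun hpS => hn.2.2 p hpS hp⟩
    · exact .inl ⟨hn.1, hmem⟩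
  have hcard : countUpTo (partialCompl q S) N ≤
      countUpTo {n | ¬ TowerMem q n} N + ∑ p ∈ T, N / (p : ℕ) ^ 2 := by
    have hT_card : (T.biUnion fun p =>
        (Finset.Ioc 0 N).filter fun n => (p : ℕ) ^ 2 ∣ n).card ≤ ∑ p ∈ T, N / (p : ℕ) ^ 2 :=
      Finset.card_biUnion_le.trans
        (Finset.sum_le_sum fun p _ => (Nat.Ioc_filter_dvd_card_eq_div N _).le)
    have hunion := (Finset.card_le_card hsub).trans
      ((Finset.card_union_le _ _).trans (Nat.add_le_add_left hT_card _))
    have hcompl : countUpTo {n | ¬ TowerMem q n} N =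
        ((Finset.Ioc 0 N).filter (· ∈ {n | ¬ TowerMem q n})).card := by
      unfold countUpTo
      congr
    rw [hcompl]
    exact hunion
  have hdiv : ((∑ p ∈ T, N / (p : ℕ) ^ 2 : ℕ) : ℝ) ≤ N * ∑ p ∈ T, 1 / ((p : ℕ) : ℝ) ^ 2 := by
    rw [Nat.cast_sum, Finset.mul_sum]
    refine Finset.sum_le_sum fun p _ => ?_
    rw [mul_one_div]
    exact_mod_cast Nat.cast_div_le (α := ℝ) (m := N) (n := (p : ℕ) ^ 2)
  have htail : ∑ p ∈ T, 1 / ((p : ℕ) : ℝ) ^ 2 ≤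
      ∑' p : {p : ℕ // p.Prime ∧ p ≠ q}, 1 / ((p : ℕ) : ℝ) ^ 2 -
        ∑ p ∈ S, 1 / ((p : ℕ) : ℝ) ^ 2 := by
    have hdisj : Disjoint T S := Finset.sdiff_disjoint
    rw [le_sub_iff_add_le, ← Finset.sum_union hdisj]
    exact (summable_one_div_sq q).sum_le_tsum _ fun _ _ => by positivity
  have hmul := mul_le_mul_of_nonneg_left htail (Nat.cast_nonneg (α := ℝ) N)
  have hcard' : (countUpTo (partialCompl q S) N : ℝ) ≤
      countUpTo {n | ¬ TowerMem q n} N + ((∑ p ∈ T, N / (p : ℕ) ^ 2 : ℕ) : ℝ) := by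
    exact_mod_cast hcard
  linarith

lemma hasNatDensity_compl {q : ℕ} (hq : q.Prime) :
    HasNatDensity {n | ¬ TowerMem q n}
      ((1 - 1 / (q : ℝ)) * ∏' p : {p : ℕ // p.Prime ∧ p ≠ q}, localFactor q p) := by
  have hprod := ((multipliable_localFactor q).hasProd).const_mul (1 - 1 / (q : ℝ))
  have htail := (summable_one_div_sq q).hasSum.const_sub
    (∑' p : {p : ℕ // p.Prime ∧ p ≠ q}, 1 / ((p : ℕ) : ℝ) ^ 2)
  rw [sub_self] at htail
  rw [HasNatDensity, Metric.tendsto_nhds]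
  intro ε hε
  obtain ⟨S, hS1, hS2⟩ := ((Metric.tendsto_nhds.1 hprod (ε / 3) (by positivity)).and
    (Metric.tendsto_nhds.1 htail (ε / 3) (by positivity))).exists
  filter_upwards [Metric.tendsto_nhds.1 (hasNatDensity_partialCompl hq S) (ε / 3) (by positivity),
    eventually_gt_atTop 0] with N h3 hN
  have hN0 : (0 : ℝ) < N := by exact_mod_cast hN
  have hle : (countUpTo {n | ¬ TowerMem q n} N : ℝ) / N ≤
      (countUpTo (partialCompl q S) N : ℝ) / N :=
    div_le_div_of_nonneg_right (by exact_mod_cast countUpTo_compl_le hq S N) hN0.le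
  have hge := div_le_div_of_nonneg_right (countUpTo_partialCompl_le hq S N) hN0.le
  rw [add_div, mul_div_cancel_left₀ _ hN0.ne'] at hge
  rw [Real.dist_eq, abs_lt] at *
  constructor <;> linarith

theorem tower_density_exists_eq_prod_compl (q : ℕ) (hq : q.Prime) :
    Tendsto (towerRatio q) atTop
      (𝓝 (1 - (1 - 1 / (q : ℝ)) *
        ∏' p : {p : ℕ // p.Prime ∧ p ≠ q},
          ((1 - 1 / ((p : ℕ) : ℝ)) *
            ∑' m : {m : ℕ // ¬ TowerMem q m}, 1 / ((p : ℕ) : ℝ) ^ (m : ℕ)))) := by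
  classical
  refine ((hasNatDensity_compl hq).const_sub 1).congr' ?_
  filter_upwards [eventually_gt_atTop 0] with N hN
  have hN0 : (N : ℝ) ≠ 0 := by positivity
  have hcard := Finset.card_filter_add_card_filter_not (s := Finset.Ioc 0 N) (TowerMem q)
  rw [Nat.card_Ioc, Nat.sub_zero] at hcard
  have hcount : countUpTo {n | ¬ TowerMem q n} N =
      ((Finset.Ioc 0 N).filter fun n => ¬ TowerMem q n).card := by
    simp only [countUpTo, Set.mem_ofPred_eq]
  have hcast : ((((Finset.Icc 1 N).filter fun n => TowerMem q n).card : ℕ) : ℝ) +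
      countUpTo {n | ¬ TowerMem q n} N = N := by
    rw [hcount]
    exact_mod_cast hcard
  rw [towerRatio, eq_div_iff hN0, sub_mul, div_mul_cancel₀ _ hN0]
  linarith
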